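/- For every Boolean function f : {0,1}^n → {0,1}, the minimum number of leaves of a hazard-free decision tree computing f satisfies 2·size(f) − 1 ≤ size_u(f) ≤ 2^{size(f)} − 1, where size(f) is the minimum number of leaves of a Boolean decision tree computing f. -/

import Mathlib

/-- Kleene's three-valued domain: `none` is the unstable value `u`,
`some b` is a stable Boolean value. -/
abbrev K : Type := Option Bool

namespace HF

variable {ι : Type} [Fintype ι] [DecidableEq ι]

/-- Instability order on inputs: `Below x y` means `x ≤ y`, i.e. each coordinate of `x`
is either `u` or equal to the corresponding coordinate of `y`. -/
def Below (x y : ι → K) : Prop := ∀ i, x i = none ∨ x i = y i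

/-- `x` is strictly below `y` in the instability order. -/
def StrictBelow (x y : ι → K) : Prop := Below x y ∧ x ≠ y

/-- `y` is strictly above `x` in the instability order. -/
def StrictAbove (y x : ι → K) : Prop := Below x y ∧ y ≠ x

/-- `x : ι → Bool` is a resolution of `y : ι → K`. -/
def Resolves (y : ι → K) (x : ι → Bool) : Prop := ∀ i, y i = none ∨ y i = some (x i)

instance (y : ι → K) : DecidablePred (Resolves y) := fun x => by
  unfold Resolves; infer_instance

/-- The hazard-free extension of a Boolean function `f`. -/
def hfExt (f : (ι → Bool) → Bool) (y : ι → K) : K :=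
  if ∀ x, Resolves y x → f x = true then some true
  else if ∀ x, Resolves y x → f x = false then some false
  else none

/-- Number of unstable (`u`) coordinates of an input. -/
def numU (x : ι → K) : ℕ := (Finset.univ.filter fun i => x i = none).card

/-- Ternary (hazard-free) decision trees: leaves are labeled by values in `K`,
internal nodes query a position and have children for responses `0`, `u`, `1`. -/
inductive TDT (ι : Type) : Type where
  | leaf : K → TDT ι
  | node : ι → TDT ι → TDT ι → TDT ι → TDT ι

namespace TDT

/-- Evaluate a ternary decision tree on an input in `K^ι`. -/
def eval : TDT ι → (ι → K) → K
  | .leaf b, _ => b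
  | .node i t0 tu t1, x =>
    match x i with
    | some false => eval t0 x
    | none => eval tu x
    | some true => eval t1 x

/-- Depth of a ternary decision tree. -/
def depth : TDT ι → ℕ
  | .leaf _ => 0
  | .node _ t0 tu t1 => max (max (depth t0) (depth tu)) (depth t1) + 1

/-- Size (number of leaves) of a ternary decision tree. -/
def size : TDT ι → ℕ
  | .leaf _ => 1
  | .node _ t0 tu t1 => size t0 + size tu + size t1

end TDT

/-- Boolean decision trees. -/
inductive BDT (ι : Type) : Type where
  | leaf : Bool → BDT ι
  | node : ι → BDT ι → BDT ι → BDT ι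

namespace BDT

/-- Evaluate a Boolean decision tree. -/
def eval : BDT ι → (ι → Bool) → Bool
  | .leaf b, _ => b
  | .node i t0 t1, x => if x i then eval t1 x else eval t0 x

/-- Depth of a Boolean decision tree. -/
def depth : BDT ι → ℕ
  | .leaf _ => 0
  | .node _ t0 t1 => max (depth t0) (depth t1) + 1

/-- Size (number of leaves) of a Boolean decision tree. -/
def size : BDT ι → ℕ
  | .leaf _ => 1
  | .node _ t0 t1 => size t0 + size t1

end BDT

/-- A ternary tree computes (the hazard-free extension of) the Boolean function `f`. -/
def ComputesHF (f : (ι → Bool) → Bool) (T : TDT ι) : Prop := ∀ x, T.eval x = hfExt f x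

/-- A ternary tree computes a `K`-valued function `g`. -/
def ComputesT (g : (ι → K) → K) (T : TDT ι) : Prop := ∀ x, T.eval x = g x

/-- A Boolean tree computes the Boolean function `f`. -/
def ComputesB (f : (ι → Bool) → Bool) (T : BDT ι) : Prop := ∀ x, T.eval x = f x

/-- A `k`-bit hazard-free decision tree for `f`: correct on all inputs with at most
`k` unstable coordinates. -/
def KComputes (k : ℕ) (f : (ι → Bool) → Bool) (T : TDT ι) : Prop :=
  ∀ x : ι → K, numU x ≤ k → T.eval x = hfExt f x

/-- Minimum depth of a ternary decision tree computing a `K`-valued function. -/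
noncomputable def depthT (g : (ι → K) → K) : ℕ :=
  sInf {d | ∃ T : TDT ι, ComputesT g T ∧ T.depth = d}

/-- Hazard-free decision tree depth of a Boolean function. -/
noncomputable def depthU (f : (ι → Bool) → Bool) : ℕ :=
  sInf {d | ∃ T : TDT ι, ComputesHF f T ∧ T.depth = d}

/-- Hazard-free decision tree size (minimum number of leaves). -/
noncomputable def sizeU (f : (ι → Bool) → Bool) : ℕ :=
  sInf {s | ∃ T : TDT ι, ComputesHF f T ∧ T.size = s}

/-- Boolean decision tree size (minimum number of leaves). -/
noncomputable def sizeB (f : (ι → Bool) → Bool) : ℕ :=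
  sInf {s | ∃ T : BDT ι, ComputesB f T ∧ T.size = s}

/-- The multiplexer function `MUX n` on `n` selector bits and `2^n` data bits. -/
def MUX (n : ℕ) (z : (Fin n ⊕ (Fin n → Bool)) → Bool) : Bool :=
  z (Sum.inr fun i => z (Sum.inl i))

/-- Hazard-free sensitivity of `g` at `x`. -/
noncomputable def sensAt (g : (ι → K) → K) (x : ι → K) : ℕ :=
  Set.ncard {i : ι | ∃ y : ι → K, y i ≠ x i ∧ (∀ j, j ≠ i → y j = x j) ∧ g y ≠ g x}

/-- Hazard-free sensitivity of `g`. -/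
noncomputable def sens (g : (ι → K) → K) : ℕ := ⨆ x : ι → K, sensAt g x

/-- Hazard-free sensitivity of `g` restricted to inputs with output value `b`. -/
noncomputable def sensVal (g : (ι → K) → K) (b : K) : ℕ :=
  ⨆ x : {x : ι → K // g x = b}, sensAt g x.1

/-- Hazard-free block sensitivity of `g` at `x`. -/
noncomputable def bsensAt (g : (ι → K) → K) (x : ι → K) : ℕ :=
  sSup {k : ℕ | ∃ B : Fin k → Finset ι, (∀ j, (B j).Nonempty) ∧
    (∀ j j', j ≠ j' → Disjoint (B j) (B j')) ∧
    ∀ j, ∃ y : ι → K, (∀ i, y i ≠ x i ↔ i ∈ B j) ∧ g y ≠ g x}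

/-- Hazard-free block sensitivity of `g`. -/
noncomputable def bsens (g : (ι → K) → K) : ℕ := ⨆ x, bsensAt g x

/-- Hazard-free certificate complexity of `g` at `x`. -/
noncomputable def ccAt (g : (ι → K) → K) (x : ι → K) : ℕ :=
  sInf {k : ℕ | ∃ S : Finset ι, S.card = k ∧
    ∀ y : ι → K, (∀ i ∈ S, y i = x i) → g y = g x}

/-- Hazard-free certificate complexity of `g`. -/
noncomputable def cc (g : (ι → K) → K) : ℕ := ⨆ x, ccAt g x

/-- Hazard-free certificate complexity of `g` restricted to inputs with output value `b`. -/
noncomputable def ccVal (g : (ι → K) → K) (b : K) : ℕ :=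
  ⨆ x : {x : ι → K // g x = b}, ccAt g x.1

/-- Boolean sensitivity of a Boolean function. -/
noncomputable def boolSens (f : (ι → Bool) → Bool) : ℕ :=
  ⨆ x : ι → Bool, Set.ncard {i : ι | f (Function.update x i (!(x i))) ≠ f x}

/-- `p` is a prime implicant of `f`. -/
def PrimeImplicant (f : (ι → Bool) → Bool) (p : ι → K) : Prop :=
  hfExt f p = some true ∧ ∀ q, StrictBelow q p → hfExt f q ≠ some true

/-- `p` is a prime implicate of `f`. -/
def PrimeImplicate (f : (ι → Bool) → Bool) (p : ι → K) : Prop :=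
  hfExt f p = some false ∧ ∀ q, StrictBelow q p → hfExt f q ≠ some false

/-- Size of an implicant/implicate: the number of stable coordinates. -/
noncomputable def isize (p : ι → K) : ℕ := Set.ncard {i : ι | p i ≠ none}

/-- Hamming distance between two inputs in `K^ι`. -/
noncomputable def hamm (x y : ι → K) : ℕ := Set.ncard {i : ι | x i ≠ y i}

/-- Hazard-free evaluation of a literal (variable and polarity). -/
def litEval (x : ι → K) (l : ι × Bool) : K := if l.2 then x l.1 else (x l.1).map not

/-- Hazard-free evaluation of a term (conjunction of literals). -/
def termEval (t : Finset (ι × Bool)) (x : ι → K) : K :=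
  if ∀ l ∈ t, litEval x l = some true then some true
  else if ∃ l ∈ t, litEval x l = some false then some false
  else none

/-- Hazard-free evaluation of a clause (disjunction of literals). -/
def clauseEval (c : Finset (ι × Bool)) (x : ι → K) : K :=
  if ∃ l ∈ c, litEval x l = some true then some true
  else if ∀ l ∈ c, litEval x l = some false then some false
  else none

/-- Hazard-free evaluation of a DNF formula (a set of terms). -/
def dnfEval (D : Finset (Finset (ι × Bool))) (x : ι → K) : K :=
  if ∃ t ∈ D, termEval t x = some true then some true
  else if ∀ t ∈ D, termEval t x = some false then some false
  else none

/-- Hazard-free evaluation of a CNF formula (a set of clauses). -/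
def cnfEval (C : Finset (Finset (ι × Bool))) (x : ι → K) : K :=
  if ∀ c ∈ C, clauseEval c x = some true then some true
  else if ∃ c ∈ C, clauseEval c x = some false then some false
  else none

/-- A function `g : K^ι → K` is weakly hazard-free: it is monotone with respect to the
instability order, and whenever all points strictly above `x` have the same value `b`
(and some such point exists), `g x = b` as well. -/
def WeaklyHF (g : (ι → K) → K) : Prop :=
  (∀ x y, Below x y → g x = none ∨ g x = g y) ∧
  (∀ x (b : K), (∃ y, StrictAbove y x) → (∀ y, StrictAbove y x → g y = b) → g x = b)

/-- The subcube `C(x)` is monochromatic for `f`. -/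
def Mono (f : (ι → Bool) → Bool) (x : ι → K) : Prop :=
  ∀ y z : ι → Bool, Resolves x y → Resolves x z → f y = f z

/-- The subcube `C(x)` is colorful for `f` (contains both a 0-point and a 1-point). -/
def Colorful (f : (ι → Bool) → Bool) (x : ι → K) : Prop :=
  ∃ y z : ι → Bool, Resolves x y ∧ Resolves x z ∧ f y ≠ f z

/-- `C(x)` is a minimal colorful cube for `f`. -/
def MinColorful (f : (ι → Bool) → Bool) (x : ι → K) : Prop :=
  Colorful f x ∧ ∀ i, x i = none →
    (Mono f (Function.update x i (some false)) ∨ Mono f (Function.update x i (some true)))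

/-- A Boolean function is non-degenerate if it depends on every input position. -/
def Nondegenerate (f : (ι → Bool) → Bool) : Prop :=
  ∀ i : ι, ∃ x y : ι → Bool, (∀ j, j ≠ i → x j = y j) ∧ x i ≠ y i ∧ f x ≠ f y

/-- The `n`-input AND function. -/
def ANDf (n : ℕ) (x : Fin n → Bool) : Bool := decide (∀ i, x i = true)

/-- The Boolean tree obtained from a ternary tree by dropping all `u`-children. -/
def TDT.toBDT {ι : Type} : TDT ι → BDT ι
  | .leaf b => .leaf (b.getD false)
  | .node i t0 _ t1 => .node i (toBDT t0) (toBDT t1)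

theorem TDT.one_le_size {ι : Type} (T : TDT ι) : 1 ≤ T.size := by
  induction T with
  | leaf b => exact le_rfl
  | node i t0 tu t1 h0 hu h1 => simp only [TDT.size]; omega

theorem TDT.two_mul_size_toBDT_le {ι : Type} (T : TDT ι) : 2 * T.toBDT.size ≤ T.size + 1 := by
  induction T with
  | leaf b => exact le_rfl
  | node i t0 tu t1 h0 _ h1 =>
    have := tu.one_le_size
    simp only [TDT.toBDT, TDT.size, BDT.size]
    omega

theorem TDT.eval_toBDT {ι : Type} (T : TDT ι) (x : ι → Bool) :
    T.toBDT.eval x = (T.eval fun i => some (x i)).getD false := by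
  induction T with
  | leaf b => rfl
  | node i t0 tu t1 h0 _ h1 =>
    cases hx : x i <;> simp [TDT.toBDT, BDT.eval, TDT.eval, hx, h0, h1]

theorem exists_resolves {ι : Type} (y : ι → K) : ∃ x, Resolves y x :=
  ⟨fun i => (y i).getD false, fun i => by cases h : y i <;> simp [h]⟩

theorem hfExt_eq_some_iff {ι : Type} [Fintype ι] [DecidableEq ι] {f : (ι → Bool) → Bool}
    {y : ι → K} {b : Bool} : hfExt f y = some b ↔ ∀ x, Resolves y x → f x = b := by
  obtain ⟨x, hx⟩ := exists_resolves y
  unfold hfExt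
  split_ifs with h1 h0
  · refine ⟨fun h => ?_, fun h => ?_⟩
    · cases h; exact h1
    · rw [← h x hx, h1 x hx]
  · refine ⟨fun h => ?_, fun h => ?_⟩
    · cases h; exact h0
    · rw [← h x hx, h0 x hx]
  · cases b <;> simp_all

theorem hfExt_some {ι : Type} [Fintype ι] [DecidableEq ι] (f : (ι → Bool) → Bool)
    (x : ι → Bool) : hfExt f (fun i => some (x i)) = some (f x) :=
  hfExt_eq_some_iff.2 fun z hz => by
    congr 1
    funext i
    simpa [eq_comm] using hz i

/-- The greatest lower bound of two values of `K` in the instability order. -/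
def meet (a b : K) : K := if a = b then a else none

theorem meet_eq_some_iff {a b : K} {c : Bool} :
    meet a b = some c ↔ a = some c ∧ b = some c := by
  unfold meet
  split_ifs with h
  · simp [← h]
  · simp only [false_iff]
    rintro ⟨rfl, rfl⟩
    exact h rfl

/-- Relabel the leaves of a ternary tree. -/
def TDT.map {ι : Type} (g : K → K) : TDT ι → TDT ι
  | .leaf b => .leaf (g b)
  | .node i t0 tu t1 => .node i (map g t0) (map g tu) (map g t1)

theorem TDT.size_map {ι : Type} (g : K → K) (T : TDT ι) : (T.map g).size = T.size := by
  induction T with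
  | leaf b => rfl
  | node i t0 tu t1 h0 hu h1 => simp only [TDT.map, TDT.size, h0, hu, h1]

theorem TDT.eval_map {ι : Type} (g : K → K) (T : TDT ι) (x : ι → K) :
    (T.map g).eval x = g (T.eval x) := by
  induction T with
  | leaf b => rfl
  | node i t0 tu t1 h0 hu h1 =>
    simp only [TDT.map, TDT.eval]
    split <;> assumption

/-- Run `T`, then `S`, and output the meet of both results. -/
def TDT.meetTree {ι : Type} (S : TDT ι) : TDT ι → TDT ι
  | .leaf b => S.map (meet b)
  | .node i t0 tu t1 => .node i (meetTree S t0) (meetTree S tu) (meetTree S t1)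

theorem TDT.size_meetTree {ι : Type} (S T : TDT ι) :
    (S.meetTree T).size = T.size * S.size := by
  induction T with
  | leaf b => simp [TDT.meetTree, TDT.size, TDT.size_map]
  | node i t0 tu t1 h0 hu h1 => simp only [TDT.meetTree, TDT.size, h0, hu, h1, add_mul]

theorem TDT.eval_meetTree {ι : Type} (S T : TDT ι) (x : ι → K) :
    (S.meetTree T).eval x = meet (T.eval x) (S.eval x) := by
  induction T with
  | leaf b => exact S.eval_map _ x
  | node i t0 tu t1 h0 hu h1 =>
    simp only [TDT.meetTree, TDT.eval]
    split <;> assumption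

theorem Resolves.update {ι : Type} [DecidableEq ι] {i : ι} {x : ι → K} {z : ι → Bool}
    (hz : Resolves x z) (hx : x i = none) (b : Bool) : Resolves x (Function.update z i b) := by
  intro j
  by_cases hj : j = i
  · subst hj; exact Or.inl hx
  · simpa [hj] using hz j

section Shannon

variable {ι : Type} [Fintype ι] [DecidableEq ι] {f g0 g1 : (ι → Bool) → Bool} {i : ι}

theorem hfExt_congr {g : (ι → Bool) → Bool} {x : ι → K}
    (h : ∀ z, Resolves x z → f z = g z) : hfExt f x = hfExt g x := by
  ext b
  simp only [hfExt_eq_some_iff]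
  exact forall₂_congr fun z hz => by rw [h z hz]

theorem hfExt_shannon (hf : ∀ z, f z = if z i then g1 z else g0 z)
    (h0 : ∀ z b, g0 (Function.update z i b) = g0 z)
    (h1 : ∀ z b, g1 (Function.update z i b) = g1 z) {x : ι → K} (hx : x i = none) :
    hfExt f x = meet (hfExt g0 x) (hfExt g1 x) := by
  ext b
  simp only [meet_eq_some_iff, hfExt_eq_some_iff]
  refine ⟨fun h => ⟨fun z hz => ?_, fun z hz => ?_⟩, fun ⟨k0, k1⟩ z hz => ?_⟩
  · simpa [hf, h0] using h _ (hz.update hx false)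
  · simpa [hf, h1] using h _ (hz.update hx true)
  · rw [hf]
    split_ifs
    exacts [k1 z hz, k0 z hz]

theorem hfExt_of_apply_eq_some (hf : ∀ z, f z = if z i then g1 z else g0 z) {x : ι → K}
    {b : Bool} (hx : x i = some b) : hfExt f x = hfExt (if b then g1 else g0) x :=
  hfExt_congr fun z hz => by
    have : b = z i := by simpa [hx] using hz i
    subst this
    rw [hf]
    split_ifs <;> rfl

end Shannon

/-- Override the coordinates of an input that are fixed by a partial assignment `ρ`. -/
def override {ι : Type} (ρ : ι → K) (z : ι → Bool) : ι → Bool := fun j => (ρ j).getD (z j)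

theorem override_update_update {ι : Type} [DecidableEq ι] (ρ : ι → K) (i : ι) (c b : Bool)
    (z : ι → Bool) :
    override (Function.update ρ i (some c)) (Function.update z i b) =
      override (Function.update ρ i (some c)) z := by
  funext j
  by_cases hj : j = i <;> simp [override, hj]

theorem override_update_of_apply_eq {ι : Type} [DecidableEq ι] {ρ : ι → K} {i : ι} {c : Bool}
    {z : ι → Bool} (hρ : ρ i = none) (hz : z i = c) :
    override (Function.update ρ i (some c)) z = override ρ z := by
  funext j
  by_cases hj : j = i
  · subst hj; simp [override, hρ, hz]
  · simp [override, hj]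

/-- The restriction of a Boolean tree of size `s` by a partial assignment is computed by a
hazard-free tree of size less than `2 ^ s`. -/
theorem BDT.exists_computesHF {ι : Type} [Fintype ι] [DecidableEq ι] (B : BDT ι) (ρ : ι → K) :
    ∃ T : TDT ι, ComputesHF (fun z => B.eval (override ρ z)) T ∧ T.size + 1 ≤ 2 ^ B.size := by
  induction B generalizing ρ with
  | leaf b =>
    exact ⟨.leaf (some b), fun x => (hfExt_eq_some_iff.2 fun _ _ => rfl).symm, le_rfl⟩
  | node i B0 B1 ih0 ih1 =>
    cases hρ : ρ i with
    | some c =>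
      cases c
      · obtain ⟨T, hT, hs⟩ := ih0 ρ
        refine ⟨T, by simpa [BDT.eval, override, hρ] using hT, hs.trans ?_⟩
        exact Nat.pow_le_pow_right two_pos (Nat.le_add_right _ _)
      · obtain ⟨T, hT, hs⟩ := ih1 ρ
        refine ⟨T, by simpa [BDT.eval, override, hρ] using hT, hs.trans ?_⟩
        exact Nat.pow_le_pow_right two_pos (Nat.le_add_left _ _)
    | none =>
      obtain ⟨T0, hT0, hs0⟩ := ih0 (Function.update ρ i (some false))
      obtain ⟨T1, hT1, hs1⟩ := ih1 (Function.update ρ i (some true))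
      refine ⟨.node i T0 (T1.meetTree T0) T1, fun x => ?_, ?_⟩
      · have hf : ∀ z, (BDT.node i B0 B1).eval (override ρ z) =
            if z i then B1.eval (override (Function.update ρ i (some true)) z)
            else B0.eval (override (Function.update ρ i (some false)) z) := by
          intro z
          have hi : override ρ z i = z i := by simp [override, hρ]
          rw [BDT.eval, hi]
          split_ifs with hz
          · rw [override_update_of_apply_eq hρ hz]
          · rw [override_update_of_apply_eq hρ (by simpa using hz)]
        rw [TDT.eval]
        split
        · next hx => rw [hT0, hfExt_of_apply_eq_some hf hx]; rfl
        · next hx =>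
          rw [TDT.eval_meetTree, hT0, hT1]
          exact (hfExt_shannon hf (fun z b => by rw [override_update_update])
            (fun z b => by rw [override_update_update]) hx).symm
        · next hx => rw [hT1, hfExt_of_apply_eq_some hf hx]; rfl
      · calc _ = (T0.size + 1) * (T1.size + 1) := by
              simp only [TDT.size, TDT.size_meetTree]; ring
          _ ≤ 2 ^ B0.size * 2 ^ B1.size := Nat.mul_le_mul hs0 hs1
          _ = _ := by rw [BDT.size, pow_add]

theorem ComputesB.exists_computesHF {ι : Type} [Fintype ι] [DecidableEq ι]
    {f : (ι → Bool) → Bool} {B : BDT ι} (hB : ComputesB f B) :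
    ∃ T : TDT ι, ComputesHF f T ∧ T.size + 1 ≤ 2 ^ B.size := by
  obtain ⟨T, hT, hs⟩ := B.exists_computesHF fun _ => none
  exact ⟨T, fun x => (hT x).trans (hfExt_congr fun z _ => hB z), hs⟩

theorem ComputesHF.computesB_toBDT {ι : Type} [Fintype ι] [DecidableEq ι]
    {f : (ι → Bool) → Bool} {T : TDT ι} (hT : ComputesHF f T) : ComputesB f T.toBDT := by
  intro x
  rw [TDT.eval_toBDT, hT, hfExt_some]
  rfl

/-- `2·size(f) − 1 ≤ size_u(f) ≤ 2^{size(f)} − 1`. -/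
theorem hazard_free_size_bounds (n : ℕ) (f : (Fin n → Bool) → Bool) :
    2 * sizeB f - 1 ≤ sizeU f ∧ sizeU f ≤ 2 ^ sizeB f - 1 := by
  constructor
  · rcases Set.eq_empty_or_nonempty {s | ∃ T : TDT (Fin n), ComputesHF f T ∧ T.size = s} with h | h
    · have hB : {s | ∃ B : BDT (Fin n), ComputesB f B ∧ B.size = s} = ∅ := by
        refine Set.eq_empty_of_forall_notMem ?_
        rintro _ ⟨B, hB, rfl⟩
        obtain ⟨T, hT, -⟩ := hB.exists_computesHF
        exact h.subset ⟨T, hT, rfl⟩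
      simp [sizeB, hB]
    · obtain ⟨T, hT, hs⟩ := Nat.sInf_mem h
      have hB : sizeB f ≤ T.toBDT.size := Nat.sInf_le ⟨_, hT.computesB_toBDT, rfl⟩
      have := T.two_mul_size_toBDT_le
      change T.size = sizeU f at hs
      omega
  · rcases Set.eq_empty_or_nonempty {s | ∃ B : BDT (Fin n), ComputesB f B ∧ B.size = s} with h | h
    · have hT : {s | ∃ T : TDT (Fin n), ComputesHF f T ∧ T.size = s} = ∅ := by
        refine Set.eq_empty_of_forall_notMem ?_
        rintro _ ⟨T, hT, rfl⟩
        exact h.subset ⟨_, hT.computesB_toBDT, rfl⟩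
      simp [sizeU, hT]
    · obtain ⟨B, hB, hs⟩ := Nat.sInf_mem h
      obtain ⟨T, hT, hTs⟩ := hB.exists_computesHF
      have hU : sizeU f ≤ T.size := Nat.sInf_le ⟨T, hT, rfl⟩
      change B.size = sizeB f at hs
      rw [hs] at hTs
      omega

end HF
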